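/- There exist two non-isomorphic trees T and T' on the same number n of vertices such that R(T) = R(T') and If₁(T) ≠ If₁(T'). Consequently, for every nonzero real σ, d_R(T,T') = 0 < d_{If₁}(T,T'), so the inequality d_R(T,T') ≥ d_{If₁}(T,T') conjectured by Dehmer, Emmert-Streib and Shi fails. -/

import Mathlib

open Finset

/-- The Randić index: `R(G) = Σ_{uv ∈ E} 1/√(deg u · deg v)`. -/
noncomputable def randic {V : Type*} [Fintype V] [DecidableEq V] (G : SimpleGraph V) : ℝ :=
  letI : DecidableRel G.Adj := Classical.decRel _
  ∑ e ∈ G.edgeFinset,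
    Sym2.lift ⟨fun u v => 1 / Real.sqrt ((G.degree u : ℝ) * (G.degree v : ℝ)),
      fun u v => by simp [mul_comm]⟩ e

/-- The degree-based entropy
`If₁(G) = log(Σᵢ degᵢ) - (1/Σᵢ degᵢ) · Σᵢ degᵢ · log degᵢ`. -/
noncomputable def If1 {V : Type*} [Fintype V] [DecidableEq V] (G : SimpleGraph V) : ℝ :=
  letI : DecidableRel G.Adj := Classical.decRel _
  Real.log (∑ i, (G.degree i : ℝ)) -
    (1 / ∑ i, (G.degree i : ℝ)) * ∑ i, (G.degree i : ℝ) * Real.log (G.degree i)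

/-- The graph distance measure on real numbers: `d_σ(a,b) = 1 - exp(-((a-b)/σ)²)`. -/
noncomputable def dMeasure (σ : ℝ) (a b : ℝ) : ℝ :=
  1 - Real.exp (-((a - b) / σ) ^ 2)

theorem randic_eq_of_degree {V : Type*} [Fintype V] [DecidableEq V] {G : SimpleGraph V}
    [DecidableRel G.Adj] {d : V → ℕ} (hd : ∀ i, G.degree i = d i) :
    randic G = ∑ e ∈ G.edgeFinset,
      Sym2.lift ⟨fun u v => 1 / √((d u : ℝ) * d v), fun u v => by simp [mul_comm]⟩ e := by
  simp only [randic, ← hd]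
  congr!

section ParentGraph

variable {n : ℕ} (p : Fin (n + 1) → Fin (n + 1))

/-- The graph on `Fin (n + 1)` in which every vertex is joined to its image under `p`. -/
def parentGraph : SimpleGraph (Fin (n + 1)) :=
  SimpleGraph.fromRel fun i j => p i = j

instance : DecidableRel (parentGraph p).Adj := fun i j =>
  inferInstanceAs (Decidable (i ≠ j ∧ (p i = j ∨ p j = i)))

variable {p}

theorem parentGraph_adj {i j : Fin (n + 1)} :
    (parentGraph p).Adj i j ↔ i ≠ j ∧ (p i = j ∨ p j = i) := Iff.rfl

theorem parentGraph_connected (hp : ∀ i, i ≠ 0 → p i < i) : (parentGraph p).Connected := by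
  have key : ∀ i, (parentGraph p).Reachable i 0 := by
    intro i
    induction i using WellFoundedLT.induction with
    | ind i ih =>
      by_cases hi : i = 0
      · rw [hi]
      · have hadj : (parentGraph p).Adj i (p i) :=
          parentGraph_adj.2 ⟨(hp i hi).ne', Or.inl rfl⟩
        exact hadj.reachable.trans (ih _ (hp i hi))
  exact { preconnected := fun i j => (key i).trans (key j).symm }

theorem injOn_parentEdge (hp : ∀ i, i ≠ 0 → p i < i) :
    Set.InjOn (fun i => s(i, p i)) ((univ.erase 0 : Finset (Fin (n + 1))) : Set _) := by
  intro i hi j hj hij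
  have hi' := hp i (by simpa using hi)
  have hj' := hp j (by simpa using hj)
  rcases Sym2.eq_iff.1 hij with ⟨h, -⟩ | ⟨h, h'⟩
  · exact h
  · rw [h'] at hi'
    rw [← h] at hj'
    exact absurd hi' hj'.asymm

theorem parentGraph_edgeFinset (h0 : p 0 = 0) (hp : ∀ i, i ≠ 0 → p i < i)
    [Fintype (parentGraph p).edgeSet] :
    (parentGraph p).edgeFinset = (univ.erase 0).image fun i => s(i, p i) := by
  ext e
  induction e using Sym2.ind with
  | _ a b =>
    simp only [SimpleGraph.mem_edgeFinset, SimpleGraph.mem_edgeSet, parentGraph_adj, mem_image,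
      mem_erase, mem_univ, and_true]
    constructor
    · rintro ⟨hab, rfl | rfl⟩
      · exact ⟨a, fun h => hab (by rw [h, h0]), rfl⟩
      · exact ⟨b, fun h => hab (by rw [h, h0]), Sym2.eq_swap⟩
    · rintro ⟨i, hi, h⟩
      have := (hp i hi).ne
      rcases Sym2.eq_iff.1 h with ⟨rfl, rfl⟩ | ⟨rfl, rfl⟩
      · exact ⟨this.symm, Or.inl rfl⟩
      · exact ⟨this, Or.inr rfl⟩

theorem parentGraph_isTree (h0 : p 0 = 0) (hp : ∀ i, i ≠ 0 → p i < i) :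
    (parentGraph p).IsTree := by
  rw [SimpleGraph.isTree_iff_connected_and_card]
  refine ⟨parentGraph_connected hp, ?_⟩
  rw [Nat.card_eq_fintype_card, ← SimpleGraph.edgeFinset_card, parentGraph_edgeFinset h0 hp,
    card_image_of_injOn (injOn_parentEdge hp)]
  simp

theorem randic_parentGraph (h0 : p 0 = 0) (hp : ∀ i, i ≠ 0 → p i < i)
    {d : Fin (n + 1) → ℕ} (hd : ∀ i, (parentGraph p).degree i = d i) :
    randic (parentGraph p) = ∑ i : Fin n, 1 / √((d i.succ : ℝ) * d (p i.succ)) := by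
  have huniv : (univ.erase 0 : Finset (Fin (n + 1))) = univ.map (Fin.succEmb n) := by
    ext i
    cases i using Fin.cases <;> simp
  rw [randic_eq_of_degree hd, parentGraph_edgeFinset h0 hp, sum_image (injOn_parentEdge hp),
    huniv, sum_map]
  rfl

end ParentGraph

theorem If1_eq_of_degree {V : Type*} [Fintype V] [DecidableEq V] {G : SimpleGraph V}
    [DecidableRel G.Adj] {d : V → ℕ} (hd : ∀ i, G.degree i = d i) :
    If1 G = Real.log (∑ i, (d i : ℝ)) -
      (1 / ∑ i, (d i : ℝ)) * ∑ i, (d i : ℝ) * Real.log (d i) := by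
  simp only [If1, ← hd]
  congr!

theorem If1_congr {V W : Type*} [Fintype V] [DecidableEq V] [Fintype W] [DecidableEq W]
    {G : SimpleGraph V} {H : SimpleGraph W} (f : G ≃g H) : If1 G = If1 H := by
  classical
  rw [If1_eq_of_degree (G := G) (d := fun v => H.degree (f v)) fun v => (f.degree_eq v).symm,
    If1_eq_of_degree (G := H) (d := fun v => H.degree v) fun _ => rfl]
  congr! 2
  · exact f.toEquiv.sum_comp fun v => (H.degree v : ℝ)
  · congr 1
    exact f.toEquiv.sum_comp fun v => (H.degree v : ℝ)
  · exact f.toEquiv.sum_comp fun v => (H.degree v : ℝ) * Real.log (H.degree v)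

theorem dMeasure_self (σ a : ℝ) : dMeasure σ a a = 0 := by
  simp [dMeasure]

theorem dMeasure_pos {σ a b : ℝ} (hσ : σ ≠ 0) (hab : a ≠ b) : 0 < dMeasure σ a b := by
  have h : (a - b) / σ ≠ 0 := div_ne_zero (sub_ne_zero.2 hab) hσ
  have : 0 < ((a - b) / σ) ^ 2 := by positivity
  rw [dMeasure, sub_pos, Real.exp_lt_one_iff]
  linarith

/-- The parent map of a tree with degrees `8, 4, 4, 2` and twelve leaves. -/
def broadParent : Fin 16 → Fin 16 :=
  ![0, 0, 0, 0, 0, 0, 0, 0, 0, 1, 1, 1, 2, 2, 2, 3]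

/-- The degree sequence of `parentGraph broadParent`. -/
def broadDegree : Fin 16 → ℕ :=
  ![8, 4, 4, 2, 1, 1, 1, 1, 1, 1, 1, 1, 1, 1, 1, 1]

/-- The parent map of a tree with degrees `8, 4, 2, 2, 2, 2` and ten leaves. -/
def longParent : Fin 16 → Fin 16 :=
  ![0, 0, 0, 0, 0, 0, 0, 0, 0, 1, 9, 10, 11, 12, 12, 12]

/-- The degree sequence of `parentGraph longParent`. -/
def longDegree : Fin 16 → ℕ :=
  ![8, 2, 1, 1, 1, 1, 1, 1, 1, 2, 2, 2, 4, 1, 1, 1]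

theorem degree_broad : ∀ i, (parentGraph broadParent).degree i = broadDegree i := by
  decide +kernel

theorem degree_long : ∀ i, (parentGraph longParent).degree i = longDegree i := by
  decide +kernel

theorem sqrt_two_powers :
    √(4 : ℝ) = 2 ∧ √(8 : ℝ) = 2 * √2 ∧ √(16 : ℝ) = 4 ∧ √(32 : ℝ) = 4 * √2 := by
  refine ⟨?_, ?_, ?_, ?_⟩ <;> rw [Real.sqrt_eq_iff_mul_self_eq (by positivity) (by positivity)] <;>
    ring_nf <;> norm_num

theorem randic_broad : randic (parentGraph broadParent) = 13 / 4 + 2 * √2 := by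
  rw [randic_parentGraph (by decide) (by decide) degree_broad]
  obtain ⟨h4, h8, h16, h32⟩ := sqrt_two_powers
  have h2 : √(2 : ℝ) * √2 = 2 := Real.mul_self_sqrt (by norm_num)
  have hinv : (√(2 : ℝ))⁻¹ = √2 / 2 := inv_eq_of_mul_eq_one_right (by linarith)
  simp [Fin.sum_univ_succ, broadParent, broadDegree]
  norm_num [h4, h8, h16, h32, hinv]
  linarith

theorem randic_long : randic (parentGraph longParent) = 13 / 4 + 2 * √2 := by
  rw [randic_parentGraph (by decide) (by decide) degree_long]
  obtain ⟨h4, h8, h16, h32⟩ := sqrt_two_powers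
  have h2 : √(2 : ℝ) * √2 = 2 := Real.mul_self_sqrt (by norm_num)
  have hinv : (√(2 : ℝ))⁻¹ = √2 / 2 := inv_eq_of_mul_eq_one_right (by linarith)
  simp [Fin.sum_univ_succ, longParent, longDegree]
  norm_num [h4, h8, h16, h32, hinv]
  linarith

theorem log_four_eight : Real.log 4 = 2 * Real.log 2 ∧ Real.log 8 = 3 * Real.log 2 := by
  constructor
  · rw [show (4 : ℝ) = 2 ^ 2 by norm_num, Real.log_pow]; norm_num
  · rw [show (8 : ℝ) = 2 ^ 3 by norm_num, Real.log_pow]; norm_num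

theorem If1_broad :
    If1 (parentGraph broadParent) = Real.log 30 - 7 / 5 * Real.log 2 := by
  obtain ⟨h4, h8⟩ := log_four_eight
  rw [If1_eq_of_degree degree_broad]
  simp [Fin.sum_univ_succ, broadDegree]
  norm_num [h4, h8]
  ring

theorem If1_long :
    If1 (parentGraph longParent) = Real.log 30 - 4 / 3 * Real.log 2 := by
  obtain ⟨h4, h8⟩ := log_four_eight
  rw [If1_eq_of_degree degree_long]
  simp [Fin.sum_univ_succ, longDegree]
  norm_num [h4, h8]
  ring

/-- There exist two non-isomorphic trees on the same number of vertices with the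
same Randić index but different degree entropy `If₁`; hence
`d_R(T,T') = 0 < d_{If₁}(T,T')` for every nonzero `σ`, refuting the conjecture
`d_R(T,T') ≥ d_{If₁}(T,T')`. -/
theorem conjecture_dR_ge_dIf1_fails :
    ∃ (n : ℕ) (T T' : SimpleGraph (Fin n)),
      T.IsTree ∧ T'.IsTree ∧ IsEmpty (T ≃g T') ∧
      randic T = randic T' ∧ If1 T ≠ If1 T' ∧
      ∀ σ : ℝ, σ ≠ 0 →
        dMeasure σ (randic T) (randic T') = 0 ∧
        0 < dMeasure σ (If1 T) (If1 T') ∧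
        ¬ dMeasure σ (randic T) (randic T') ≥ dMeasure σ (If1 T) (If1 T') := by
  have hR := randic_broad.trans randic_long.symm
  have hI : If1 (parentGraph broadParent) ≠ If1 (parentGraph longParent) := by
    have := Real.log_pos one_lt_two
    rw [If1_broad, If1_long]
    intro h
    linarith
  refine ⟨16, parentGraph broadParent, parentGraph longParent,
    parentGraph_isTree (by decide) (by decide), parentGraph_isTree (by decide) (by decide),
    ⟨fun f => hI (If1_congr f)⟩, hR, hI, fun σ hσ => ?_⟩
  have hpos := dMeasure_pos hσ hI
  rw [hR, dMeasure_self]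
  exact ⟨rfl, hpos, not_le.2 hpos⟩
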